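/- arXiv:2310.16098 — 2 statements merged into one kernel-verified Lean document; each statement's English description precedes it below -/
import Mathlib

section
/- (Increasing inequality.) Let T > 0 and let ρ : (0,∞) × [0,T] → [0,∞) be such that: (i) for each t, ρ(·,t) is continuous and integrable with ∫₀^∞ ρ(w,t) dw = 1 and ∫₀^∞ w ρ(w,t) dw = 1; (ii) ρ is C¹ in t and the function w ↦ D[w,ρ(·,t)] ρ(w,t) is C² in w; (iii) ρ satisfies the Fokker–Planck equation ∂ρ/∂t (w,t) = ∂²/∂w² [ D[w,ρ(·,t)] ρ(w,t) ] for all w > 0 and t ∈ (0,T); (iv) the map t ↦ G(t) := 1 − ∫₀^∞ ∫₀^∞ min(w,x) ρ(w,t) ρ(x,t) dx dw is differentiable with dG/dt = −2 ∫₀^∞ ∫₀^∞ min(w,x) ρ(x,t) (∂ρ/∂t)(w,t) dx dw (differentiation under the integral sign); and (v) for each t, the boundary terms in integration by parts vanish: F(w) ∂/∂w[Dρ](w,t) − F′(w) D[w,ρ(·,t)] ρ(w,t) → 0 as w → 0⁺ and w → ∞, where F(w) = −2 ∫₀^∞ min(w,x) ρ(x,t) dx and F′(w) = −2 ∫_w^∞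 ρ(x,t) dx, with the relevant integrands integrable. Then dG/dt (t) = 2 ∫₀^∞ D[w,ρ(·,t)] ρ(w,t)² dw ≥ 0 for all t ∈ (0,T), so the Gini coefficient G(t) is monotone nondecreasing in time. -/
open MeasureTheory Set Filter

/-- The diffusion kernel of the modified Yard-Sale Model:
`κ(w,x) = min(w,x)²` if `min(w,x) < 1` and `κ(w,x) = min(w,x)` otherwise. -/
noncomputable def mysmKernel (w x : ℝ) : ℝ :=
  if min w x < 1 then (min w x) ^ 2 else min w x

lemma integral_Ioi_of_hasDerivAt_of_tendsto_nhdsGT {f f' : ℝ → ℝ} {a l m : ℝ}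
    (hderiv : ∀ x ∈ Ioi a, HasDerivAt f (f' x) x) (f'int : IntegrableOn f' (Ioi a))
    (hl : Tendsto f (nhdsWithin a (Ioi a)) (nhds l)) (hm : Tendsto f atTop (nhds m)) :
    ∫ x in Ioi a, f' x = m - l := by
  have h := integral_Ioi_deriv_mul_eq_sub (u := 1) (u' := 0) (v := f) (v' := f') (a := a)
    (fun x _ => hasDerivAt_const x 1) hderiv (by simpa using f'int) (by simpa using hl)
    (by simpa using hm)
  simpa using h

section GiniPotential

variable {f : ℝ → ℝ}

lemma hasDerivAt_integral_zero_of_continuousOn_Ioi (hi : IntegrableOn f (Ioi 0))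
    (hc : ContinuousOn f (Ioi 0)) {w : ℝ} (hw : 0 < w) :
    HasDerivAt (fun u => ∫ x in (0 : ℝ)..u, f x) (f w) w := by
  refine intervalIntegral.integral_hasDerivAt_right ?_ ?_ (hc.continuousAt (Ioi_mem_nhds hw))
  · rw [intervalIntegrable_iff_integrableOn_Ioc_of_le hw.le]
    exact hi.mono_set Ioc_subset_Ioi_self
  · exact hc.stronglyMeasurableAtFilter isOpen_Ioi w hw

lemma integral_Ioi_eq_sub_integral_zero (hi : IntegrableOn f (Ioi 0)) {w : ℝ} (hw : 0 < w) :
    ∫ x in Ioi w, f x = (∫ x in Ioi (0 : ℝ), f x) - ∫ x in (0 : ℝ)..w, f x := by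
  rw [← intervalIntegral.integral_interval_add_Ioi hi (hi.mono_set (Ioi_subset_Ioi hw.le))]
  ring

lemma hasDerivAt_integral_Ioi_of_continuousOn (hi : IntegrableOn f (Ioi 0))
    (hc : ContinuousOn f (Ioi 0)) {w : ℝ} (hw : 0 < w) :
    HasDerivAt (fun u => ∫ x in Ioi u, f x) (-f w) w := by
  refine ((hasDerivAt_integral_zero_of_continuousOn_Ioi hi hc hw).const_sub
    (∫ x in Ioi (0 : ℝ), f x)).congr_of_eventuallyEq ?_
  filter_upwards [Ioi_mem_nhds hw] with u hu
  exact integral_Ioi_eq_sub_integral_zero hi hu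

lemma integral_min_mul_eq (hi : IntegrableOn f (Ioi 0))
    (hxi : IntegrableOn (fun x => x * f x) (Ioi 0)) {w : ℝ} (hw : 0 < w) :
    ∫ x in Ioi (0 : ℝ), min w x * f x =
      (∫ x in (0 : ℝ)..w, x * f x) + w * ∫ x in Ioi w, f x := by
  have h_left : EqOn (fun x => min w x * f x) (fun x => x * f x) (Ioc 0 w) := fun x hx => by
    simp only [min_eq_right hx.2]
  have h_right : EqOn (fun x => min w x * f x) (fun x => w * f x) (Ioi w) := fun x hx => by
    simp only [min_eq_left (le_of_lt (mem_Ioi.1 hx))]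
  rw [← Ioc_union_Ioi_eq_Ioi hw.le, setIntegral_union (Ioc_disjoint_Ioi le_rfl) measurableSet_Ioi,
    setIntegral_congr_fun measurableSet_Ioc h_left, setIntegral_congr_fun measurableSet_Ioi h_right,
    intervalIntegral.integral_of_le hw.le, integral_const_mul]
  · exact (hxi.mono_set Ioc_subset_Ioi_self).congr_fun h_left.symm measurableSet_Ioc
  · exact IntegrableOn.congr_fun ((hi.mono_set (Ioi_subset_Ioi hw.le)).const_mul w) h_right.symm
      measurableSet_Ioi

lemma hasDerivAt_integral_min_mul (hi : IntegrableOn f (Ioi 0))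
    (hxi : IntegrableOn (fun x => x * f x) (Ioi 0)) (hc : ContinuousOn f (Ioi 0))
    {w : ℝ} (hw : 0 < w) :
    HasDerivAt (fun u => ∫ x in Ioi (0 : ℝ), min u x * f x) (∫ x in Ioi w, f x) w := by
  have h := (hasDerivAt_integral_zero_of_continuousOn_Ioi hxi (continuousOn_id.mul hc) hw).add
    ((hasDerivAt_id w).mul (hasDerivAt_integral_Ioi_of_continuousOn hi hc hw))
  refine HasDerivAt.congr_of_eventuallyEq (h.congr_deriv ?_) ?_
  · simp
  · filter_upwards [Ioi_mem_nhds hw] with u hu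
    exact integral_min_mul_eq hi hxi hu

end GiniPotential

lemma mysmKernel_nonneg {w x : ℝ} (hw : 0 ≤ w) (hx : 0 ≤ x) : 0 ≤ mysmKernel w x := by
  have := le_min hw hx
  unfold mysmKernel
  split_ifs <;> positivity

/-- **Increasing inequality.**  Let `ρ(t,·)` be a continuous density on `(0,∞)` with
unit zeroth and first moments, `C¹` in `t`, with `w ↦ D[w,ρ(·,t)] ρ(w,t)` `C²` in `w`,
solving the modified Yard-Sale Fokker–Planck equation
`∂ρ/∂t = ∂²/∂w² [D[w,ρ(·,t)] ρ(w,t)]` where `D[w,ρ] = (γ/2) ∫₀^∞ κ(w,x) ρ(x) dx`.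
Assuming differentiation under the integral sign for the Gini coefficient
`G(t) = 1 − ∬ min(w,x) ρ(w,t) ρ(x,t)` and vanishing boundary terms in the
integration by parts, `dG/dt(t) = 2 ∫₀^∞ D[w,ρ(·,t)] ρ(w,t)² dw ≥ 0`:
the Gini coefficient is monotone nondecreasing. -/
theorem gini_increasing_modified_ysm
    (T γ : ℝ) (hT : 0 < T) (hγ : 0 < γ)
    (ρ : ℝ → ℝ → ℝ)  -- ρ t w : density in w at time t
    (D : ℝ → ℝ → ℝ)
    (hD : ∀ t w, D t w = γ / 2 * ∫ x in Ioi (0 : ℝ), mysmKernel w x * ρ t x)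
    (G : ℝ → ℝ)
    (hG : ∀ t, G t = 1 - ∫ w in Ioi (0 : ℝ), ∫ x in Ioi (0 : ℝ), min w x * ρ t w * ρ t x)
    -- (i) for each time, a continuous density with unit zeroth and first moments
    (hcont : ∀ t ∈ Icc (0 : ℝ) T, ContinuousOn (ρ t) (Ioi 0))
    (hnn : ∀ t ∈ Icc (0 : ℝ) T, ∀ w ∈ Ioi (0 : ℝ), 0 ≤ ρ t w)
    (hint : ∀ t ∈ Icc (0 : ℝ) T, IntegrableOn (ρ t) (Ioi 0))
    (hmass : ∀ t ∈ Icc (0 : ℝ) T, (∫ w in Ioi (0 : ℝ), ρ t w) = 1)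
    (hmean : ∀ t ∈ Icc (0 : ℝ) T, (∫ w in Ioi (0 : ℝ), w * ρ t w) = 1)
    -- (ii) C¹ in time (with time derivative ρt) and `w ↦ D ρ` C² in wealth
    (ρt : ℝ → ℝ → ℝ)
    (hC1 : ∀ t ∈ Ioo (0 : ℝ) T, ∀ w ∈ Ioi (0 : ℝ),
      HasDerivAt (fun s => ρ s w) (ρt t w) t)
    (hC2 : ∀ t ∈ Ioo (0 : ℝ) T, ContDiffOn ℝ 2 (fun w => D t w * ρ t w) (Ioi 0))
    -- (iii) the Fokker–Planck equation ∂ρ/∂t = ∂²/∂w²[D ρ]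
    (hFP : ∀ t ∈ Ioo (0 : ℝ) T, ∀ w ∈ Ioi (0 : ℝ),
      ρt t w = deriv (deriv (fun v => D t v * ρ t v)) w)
    -- (iv) differentiation under the integral sign for G
    (hdiff : ∀ t ∈ Ioo (0 : ℝ) T,
      HasDerivAt G
        (-2 * ∫ w in Ioi (0 : ℝ), (∫ x in Ioi (0 : ℝ), min w x * ρ t x) * ρt t w) t)
    -- (v) vanishing boundary terms and integrability for the integration by parts
    (F F' : ℝ → ℝ → ℝ)
    (hF : ∀ t w, F t w = -2 * ∫ x in Ioi (0 : ℝ), min w x * ρ t x)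
    (hF' : ∀ t w, F' t w = -2 * ∫ x in Ioi w, ρ t x)
    (hbd0 : ∀ t ∈ Ioo (0 : ℝ) T,
      Tendsto (fun w => F t w * deriv (fun v => D t v * ρ t v) w
          - F' t w * (D t w * ρ t w)) (nhdsWithin 0 (Ioi 0)) (nhds 0))
    (hbdtop : ∀ t ∈ Ioo (0 : ℝ) T,
      Tendsto (fun w => F t w * deriv (fun v => D t v * ρ t v) w
          - F' t w * (D t w * ρ t w)) atTop (nhds 0))
    (hint1 : ∀ t ∈ Ioo (0 : ℝ) T,
      IntegrableOn (fun w => F t w * deriv (deriv (fun v => D t v * ρ t v)) w) (Ioi 0))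
    (hint2 : ∀ t ∈ Ioo (0 : ℝ) T,
      IntegrableOn (fun w => ρ t w * (D t w * ρ t w)) (Ioi 0)) :
    ∀ t ∈ Ioo (0 : ℝ) T,
      HasDerivAt G (2 * ∫ w in Ioi (0 : ℝ), D t w * ρ t w ^ 2) t ∧
      0 ≤ 2 * ∫ w in Ioi (0 : ℝ), D t w * ρ t w ^ 2 := by
  intro t ht
  have htc : t ∈ Icc (0 : ℝ) T := Ioo_subset_Icc_self ht
  have hxi : IntegrableOn (fun x => x * ρ t x) (Ioi 0) := by
    by_contra h
    exact one_ne_zero ((hmean t htc).symm.trans (integral_undef h))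
  set g : ℝ → ℝ := fun v => D t v * ρ t v with hg
  have hg1 : ∀ w ∈ Ioi (0 : ℝ), HasDerivAt g (deriv g w) w := fun w hw =>
    (((hC2 t ht).differentiableOn (by norm_num)).differentiableAt
      (Ioi_mem_nhds hw)).hasDerivAt
  have hg2 : ∀ w ∈ Ioi (0 : ℝ), HasDerivAt (deriv g) (deriv (deriv g) w) w := fun w hw =>
    ((((hC2 t ht).deriv_of_isOpen (m := 1) isOpen_Ioi (by norm_num)).differentiableOn
      (by norm_num)).differentiableAt (Ioi_mem_nhds hw)).hasDerivAt
  have hF1 : ∀ w ∈ Ioi (0 : ℝ), HasDerivAt (F t) (F' t w) w := fun w hw => by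
    rw [hF', funext (hF t)]
    exact (hasDerivAt_integral_min_mul (hint t htc) hxi (hcont t htc) hw).const_mul (-2)
  have hF2 : ∀ w ∈ Ioi (0 : ℝ), HasDerivAt (F' t) (2 * ρ t w) w := fun w hw => by
    rw [funext (hF' t)]
    exact ((hasDerivAt_integral_Ioi_of_continuousOn (hint t htc) (hcont t htc) hw).const_mul
      (-2)).congr_deriv (by ring)
  have h_parts : (∫ w in Ioi (0 : ℝ), F t w * deriv (deriv g) w) =
      ∫ w in Ioi (0 : ℝ), 2 * (ρ t w * g w) := by
    have h := integral_Ioi_of_hasDerivAt_of_tendsto_nhdsGT (a := (0 : ℝ))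
      (f := fun w => F t w * deriv g w - F' t w * g w)
      (f' := fun w => F t w * deriv (deriv g) w - 2 * (ρ t w * g w))
      (fun w hw => (((hF1 w hw).mul (hg2 w hw)).sub ((hF2 w hw).mul (hg1 w hw))).congr_deriv
        (by ring))
      ((hint1 t ht).sub ((hint2 t ht).const_mul 2)) (hbd0 t ht) (hbdtop t ht)
    rw [integral_sub (hint1 t ht) ((hint2 t ht).const_mul 2)] at h
    linarith
  have h_deriv : (-2 * ∫ w in Ioi (0 : ℝ), (∫ x in Ioi (0 : ℝ), min w x * ρ t x) * ρt t w) =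
      2 * ∫ w in Ioi (0 : ℝ), D t w * ρ t w ^ 2 := by
    rw [← integral_const_mul, ← integral_const_mul]
    trans ∫ w in Ioi (0 : ℝ), F t w * deriv (deriv g) w
    · refine setIntegral_congr_fun measurableSet_Ioi fun w hw => ?_
      simp only [hFP t ht w hw, hF, mul_assoc, hg]
    · rw [h_parts]
      congr 1 with w
      simp only [hg]
      ring
  refine ⟨h_deriv ▸ hdiff t ht, mul_nonneg zero_le_two <|
    setIntegral_nonneg measurableSet_Ioi fun w hw => mul_nonneg ?_ (sq_nonneg _)⟩
  rw [hD]
  exact mul_nonneg (by positivity) <| setIntegral_nonneg measurableSet_Ioi fun x hx =>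
    mul_nonneg (mysmKernel_nonneg (le_of_lt hw) (le_of_lt hx)) (hnn t htc x hx)
end

section
/- (Bounding inequality.) Let T > 0, γ > 0, and let ρ : (0,∞) × [0,T] → [0,∞) satisfy all the hypotheses of the increasing-inequality theorem (ρ(·,t) a continuous density with unit zeroth and first moments, C¹ in t and C² in w, solving ∂ρ/∂t = ∂²/∂w²[D[w,ρ(·,t)] ρ(w,t)], with differentiation under the integral sign valid for G(t) and vanishing boundary terms in integration by parts), and additionally suppose ρ(·,t) ∈ L^∞(0,∞) for each t ∈ (0,T). Then for all t ∈ (0,T), dG/dt (t) ≤ γ ‖ρ(·,t)‖_∞ (1 − G(t)), where G(t) = 1 − ∫₀^∞ ∫₀^∞ min(w,x) ρ(w,t) ρ(x,t) dx dw. -/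
open MeasureTheory Set Filter

/-- The kernel is dominated by `min w x` for nonnegative arguments. -/
lemma mysmKernel_le_min {w x : ℝ} (hw : 0 ≤ w) (hx : 0 ≤ x) : mysmKernel w x ≤ min w x := by
  have h0 : 0 ≤ min w x := le_min hw hx
  unfold mysmKernel
  split_ifs with h
  · nlinarith
  · exact le_rfl

lemma measurable_mysmKernel (w : ℝ) : Measurable (mysmKernel w) := by
  have hm : Measurable fun x : ℝ => min w x := measurable_const.min measurable_id
  exact Measurable.ite (measurableSet_lt hm measurable_const) (hm.pow_const 2) hm

lemma integrableOn_min_mul {p : ℝ → ℝ} (hp : IntegrableOn p (Ioi 0)) {w : ℝ} (hw : 0 ≤ w) :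
    IntegrableOn (fun x => min w x * p x) (Ioi 0) := by
  refine Integrable.bdd_mul (c := w) hp (by fun_prop) ?_
  filter_upwards [ae_restrict_mem measurableSet_Ioi] with x hx
  rw [Real.norm_of_nonneg (le_min hw (le_of_lt hx))]
  exact min_le_left _ _

/-- Kernel averages are dominated by averages of `min w x`. -/
lemma setIntegral_mysmKernel_mul_le {p : ℝ → ℝ} (hp : IntegrableOn p (Ioi 0))
    (hp0 : ∀ x ∈ Ioi (0 : ℝ), 0 ≤ p x) {w : ℝ} (hw : 0 ≤ w) :
    ∫ x in Ioi (0 : ℝ), mysmKernel w x * p x ≤ ∫ x in Ioi (0 : ℝ), min w x * p x := by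
  have hle : ∀ x ∈ Ioi (0 : ℝ), mysmKernel w x * p x ≤ min w x * p x := fun x hx =>
    mul_le_mul_of_nonneg_right (mysmKernel_le_min hw (le_of_lt hx)) (hp0 x hx)
  refine setIntegral_mono_on ?_ (integrableOn_min_mul hp hw) measurableSet_Ioi hle
  refine Integrable.mono' (integrableOn_min_mul hp hw)
    ((measurable_mysmKernel w).aestronglyMeasurable.mul hp.aestronglyMeasurable) ?_
  filter_upwards [ae_restrict_mem measurableSet_Ioi] with x hx
  rw [Real.norm_of_nonneg (mul_nonneg (mysmKernel_nonneg hw (le_of_lt hx)) (hp0 x hx))]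
  exact hle x hx

lemma hasDerivAt_setIntegral_min_mul {p : ℝ → ℝ} (hp : IntegrableOn p (Ioi 0))
    {w : ℝ} (hw : 0 < w) :
    HasDerivAt (fun v => ∫ x in Ioi (0 : ℝ), min v x * p x) (∫ x in Ioi w, p x) w := by
  have hset : ∫ x in Ioi w, p x = ∫ x in Ioi (0 : ℝ), (Ioi w).indicator p x := by
    rw [setIntegral_indicator measurableSet_Ioi, inter_eq_right.2 (Ioi_subset_Ioi hw.le)]
  rw [hset]
  refine (hasDerivAt_integral_of_dominated_loc_of_lip (F := fun v x => min v x * p x)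
    (bound := p) univ_mem ?_
    (integrableOn_min_mul hp hw.le) ?_ ?_ hp ?_).2
  · refine Eventually.of_forall fun v => ?_
    exact (by fun_prop : Continuous fun x : ℝ => min v x).aestronglyMeasurable.mul
      hp.aestronglyMeasurable
  · exact hp.aestronglyMeasurable.indicator measurableSet_Ioi
  · refine Eventually.of_forall fun x => LipschitzOnWith.of_dist_le_mul fun a _ b _ => ?_
    have hab : |min a x - min b x| ≤ |a - b| := abs_inf_sub_inf_le_abs a b x
    simp only [Real.dist_eq, ← sub_mul, abs_mul, Real.coe_nnabs]
    rw [mul_comm]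
    gcongr
  · have hne : ∀ᵐ x ∂(volume.restrict (Ioi (0 : ℝ))), x ≠ w :=
      ae_restrict_of_ae (by simp [ae_iff, measure_singleton])
    filter_upwards [hne] with x hx
    rcases lt_or_gt_of_ne hx with h | h
    · rw [indicator_of_notMem (by simpa using h.le)]
      refine (hasDerivAt_const w (x * p x)).congr_of_eventuallyEq ?_
      filter_upwards [lt_mem_nhds h] with v hv
      rw [min_eq_right hv.le]
    · rw [indicator_of_mem (by simpa using h)]
      refine HasDerivAt.congr_of_eventuallyEq (f := fun v => v * p x)
        (by simpa using (hasDerivAt_id w).mul_const (p x)) ?_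
      filter_upwards [gt_mem_nhds h] with v hv
      rw [min_eq_left hv.le]

lemma hasDerivAt_setIntegral_Ioi {p : ℝ → ℝ} (hp : IntegrableOn p (Ioi 0))
    (hc : ContinuousOn p (Ioi 0)) {w : ℝ} (hw : 0 < w) :
    HasDerivAt (fun v => ∫ x in Ioi v, p x) (-p w) w := by
  have hi : ∀ {v : ℝ}, 0 < v → IntegrableOn p (Ioi v) := fun hv =>
    hp.mono_set (Ioi_subset_Ioi hv.le)
  have hd : HasDerivAt (fun v => ∫ x in w..v, p x) (p w) w :=
    intervalIntegral.integral_hasDerivAt_right (by simp)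
      (hc.stronglyMeasurableAtFilter isOpen_Ioi w hw) (hc.continuousAt (Ioi_mem_nhds hw))
  refine (hd.const_sub (∫ x in Ioi w, p x)).congr_of_eventuallyEq ?_
  filter_upwards [Ioi_mem_nhds hw] with v hv
  rw [← intervalIntegral.integral_Ioi_sub_Ioi' (hi hw) (hi hv)]
  ring

/-- The fundamental theorem of calculus on `(a, ∞)` for a function with vanishing limits at both
ends. -/
lemma setIntegral_Ioi_eq_zero_of_tendsto {a : ℝ} {u u' : ℝ → ℝ}
    (hu : ∀ x ∈ Ioi a, HasDerivAt u (u' x) x) (hint : IntegrableOn u' (Ioi a))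
    (h0 : Tendsto u (nhdsWithin a (Ioi a)) (nhds 0)) (htop : Tendsto u atTop (nhds 0)) :
    ∫ x in Ioi a, u' x = 0 := by
  have h := integral_Ioi_deriv_mul_eq_sub (v := fun _ => (1 : ℝ)) (v' := fun _ => 0) hu
    (fun x _ => hasDerivAt_const x 1)
    (hint.congr_fun (fun x _ => by simp) measurableSet_Ioi)
    (a' := 0) (b' := 0) (h0.congr fun x => by simp) (htop.congr fun x => by simp)
  simpa using h

lemma ae_le_toReal_eLpNorm_top {α : Type*} [MeasurableSpace α] {μ : Measure α} {p : α → ℝ}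
    (hp : eLpNorm p ⊤ μ ≠ ⊤) : ∀ᵐ x ∂μ, p x ≤ (eLpNorm p ⊤ μ).toReal := by
  have h := enorm_ae_le_eLpNormEssSup p μ
  filter_upwards [h] with x hx
  rw [← eLpNorm_exponent_top] at hx
  refine (le_abs_self _).trans ?_
  rw [← Real.norm_eq_abs, ← toReal_enorm]
  exact ENNReal.toReal_mono hp hx

/-- **Bounding inequality.**  Under the hypotheses of the increasing-inequality
theorem (continuous densities with unit zeroth and first moments, `C¹` in time,
`w ↦ D ρ` `C²` in wealth, solving `∂ρ/∂t = ∂²/∂w²[D[w,ρ(·,t)] ρ(w,t)]`, with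
differentiation under the integral sign for `G(t)` and vanishing boundary terms
in the integration by parts), if in addition `ρ(·,t) ∈ L^∞(0,∞)` for each
`t ∈ (0,T)`, then `dG/dt(t) ≤ γ ‖ρ(·,t)‖_∞ (1 − G(t))` for all `t ∈ (0,T)`. -/
theorem gini_bounding_inequality_modified_ysm
    (T γ : ℝ) (hT : 0 < T) (hγ : 0 < γ)
    (ρ : ℝ → ℝ → ℝ)  -- ρ t w : density in w at time t
    (D : ℝ → ℝ → ℝ)
    (hD : ∀ t w, D t w = γ / 2 * ∫ x in Ioi (0 : ℝ), mysmKernel w x * ρ t x)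
    (G : ℝ → ℝ)
    (hG : ∀ t, G t = 1 - ∫ w in Ioi (0 : ℝ), ∫ x in Ioi (0 : ℝ), min w x * ρ t w * ρ t x)
    -- (i) for each time, a continuous density with unit zeroth and first moments
    (hcont : ∀ t ∈ Icc (0 : ℝ) T, ContinuousOn (ρ t) (Ioi 0))
    (hnn : ∀ t ∈ Icc (0 : ℝ) T, ∀ w ∈ Ioi (0 : ℝ), 0 ≤ ρ t w)
    (hint : ∀ t ∈ Icc (0 : ℝ) T, IntegrableOn (ρ t) (Ioi 0))
    (hmass : ∀ t ∈ Icc (0 : ℝ) T, (∫ w in Ioi (0 : ℝ), ρ t w) = 1)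
    (hmean : ∀ t ∈ Icc (0 : ℝ) T, (∫ w in Ioi (0 : ℝ), w * ρ t w) = 1)
    -- (ii) C¹ in time (with time derivative ρt) and `w ↦ D ρ` C² in wealth
    (ρt : ℝ → ℝ → ℝ)
    (hC1 : ∀ t ∈ Ioo (0 : ℝ) T, ∀ w ∈ Ioi (0 : ℝ),
      HasDerivAt (fun s => ρ s w) (ρt t w) t)
    (hC2 : ∀ t ∈ Ioo (0 : ℝ) T, ContDiffOn ℝ 2 (fun w => D t w * ρ t w) (Ioi 0))
    -- (iii) the Fokker–Planck equation ∂ρ/∂t = ∂²/∂w²[D ρ]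
    (hFP : ∀ t ∈ Ioo (0 : ℝ) T, ∀ w ∈ Ioi (0 : ℝ),
      ρt t w = deriv (deriv (fun v => D t v * ρ t v)) w)
    -- (iv) differentiation under the integral sign for G
    (hdiff : ∀ t ∈ Ioo (0 : ℝ) T,
      HasDerivAt G
        (-2 * ∫ w in Ioi (0 : ℝ), (∫ x in Ioi (0 : ℝ), min w x * ρ t x) * ρt t w) t)
    -- (v) vanishing boundary terms and integrability for the integration by parts
    (F F' : ℝ → ℝ → ℝ)
    (hF : ∀ t w, F t w = -2 * ∫ x in Ioi (0 : ℝ), min w x * ρ t x)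
    (hF' : ∀ t w, F' t w = -2 * ∫ x in Ioi w, ρ t x)
    (hbd0 : ∀ t ∈ Ioo (0 : ℝ) T,
      Tendsto (fun w => F t w * deriv (fun v => D t v * ρ t v) w
          - F' t w * (D t w * ρ t w)) (nhdsWithin 0 (Ioi 0)) (nhds 0))
    (hbdtop : ∀ t ∈ Ioo (0 : ℝ) T,
      Tendsto (fun w => F t w * deriv (fun v => D t v * ρ t v) w
          - F' t w * (D t w * ρ t w)) atTop (nhds 0))
    (hint1 : ∀ t ∈ Ioo (0 : ℝ) T,
      IntegrableOn (fun w => F t w * deriv (deriv (fun v => D t v * ρ t v)) w) (Ioi 0))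
    (hint2 : ∀ t ∈ Ioo (0 : ℝ) T,
      IntegrableOn (fun w => ρ t w * (D t w * ρ t w)) (Ioi 0))
    -- additionally, ρ(·,t) ∈ L^∞(0,∞) for each t ∈ (0,T)
    (hbdd : ∀ t ∈ Ioo (0 : ℝ) T, eLpNorm (ρ t) ⊤ (volume.restrict (Ioi 0)) ≠ ⊤) :
    ∀ t ∈ Ioo (0 : ℝ) T,
      deriv G t ≤ γ * (eLpNorm (ρ t) ⊤ (volume.restrict (Ioi 0))).toReal * (1 - G t) := by
  intro t ht
  have htc : t ∈ Icc (0 : ℝ) T := Ioo_subset_Icc_self ht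
  have hp := hint t htc
  have hp0 := hnn t htc
  have hpc := hcont t htc
  have hmean1 := hmean t htc
  set N := (eLpNorm (ρ t) ⊤ (volume.restrict (Ioi 0))).toReal
  set f : ℝ → ℝ := fun v => D t v * ρ t v with hf
  set M : ℝ → ℝ := fun w => ∫ x in Ioi (0 : ℝ), min w x * ρ t x with hM
  have hxp : IntegrableOn (fun x => x * ρ t x) (Ioi 0) :=
    Integrable.of_integral_ne_zero (by rw [hmean1]; exact one_ne_zero)
  have hMderiv : ∀ w ∈ Ioi (0 : ℝ), HasDerivAt M (∫ x in Ioi w, ρ t x) w := fun w hw =>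
    hasDerivAt_setIntegral_min_mul hp hw
  have hM0 : ∀ w ∈ Ioi (0 : ℝ), 0 ≤ M w := fun w hw =>
    setIntegral_nonneg measurableSet_Ioi fun x hx =>
      mul_nonneg (le_min (le_of_lt hw) (le_of_lt hx)) (hp0 x hx)
  have hM1 : ∀ w ∈ Ioi (0 : ℝ), M w ≤ 1 := fun w hw => by
    rw [← hmean1]
    exact setIntegral_mono_on (integrableOn_min_mul hp (le_of_lt hw)) hxp measurableSet_Ioi
      fun x hx => mul_le_mul_of_nonneg_right (min_le_right _ _) (hp0 x hx)
  have hMc : ContinuousOn M (Ioi 0) := fun w hw =>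
    (hMderiv w hw).continuousAt.continuousWithinAt
  have hMp : IntegrableOn (fun w => M w * ρ t w) (Ioi 0) := by
    refine Integrable.bdd_mul (c := 1) hp (hMc.aestronglyMeasurable measurableSet_Ioi) ?_
    filter_upwards [ae_restrict_mem measurableSet_Ioi] with w hw
    rw [Real.norm_of_nonneg (hM0 w hw)]
    exact hM1 w hw
  have hGM : 1 - G t = ∫ w in Ioi (0 : ℝ), M w * ρ t w := by
    rw [hG, sub_sub_cancel]
    refine integral_congr_ae (Eventually.of_forall fun w => ?_)
    simp only [hM]
    rw [← integral_mul_const]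
    exact integral_congr_ae (Eventually.of_forall fun x => by ring)
  have hDM : ∀ w ∈ Ioi (0 : ℝ), D t w ≤ γ / 2 * M w := fun w hw => by
    rw [hD]
    exact mul_le_mul_of_nonneg_left (setIntegral_mysmKernel_mul_le hp hp0 (le_of_lt hw))
      (by positivity)
  have hFd : ∀ w ∈ Ioi (0 : ℝ), HasDerivAt (F t) (F' t w) w := fun w hw => by
    rw [hF', show F t = fun v => -2 * M v from funext fun v => hF t v]
    exact (hMderiv w hw).const_mul (-2)
  have hF'd : ∀ w ∈ Ioi (0 : ℝ), HasDerivAt (F' t) (2 * ρ t w) w := fun w hw => by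
    rw [show F' t = fun v => -2 * ∫ x in Ioi v, ρ t x from funext fun v => hF' t v]
    exact ((hasDerivAt_setIntegral_Ioi hp hpc hw).const_mul (-2)).congr_deriv (by ring)
  have hfd : ∀ w ∈ Ioi (0 : ℝ), HasDerivAt f (deriv f w) w := fun w hw =>
    (((hC2 t ht).differentiableOn two_ne_zero).differentiableAt (Ioi_mem_nhds hw)).hasDerivAt
  have hfdd : ∀ w ∈ Ioi (0 : ℝ), HasDerivAt (deriv f) (deriv (deriv f) w) w := fun w hw =>
    ((((hC2 t ht).deriv_of_isOpen (m := 1) isOpen_Ioi (by norm_num)).differentiableOn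
      one_ne_zero).differentiableAt (Ioi_mem_nhds hw)).hasDerivAt
  have hzero : ∫ w in Ioi (0 : ℝ), (F t w * deriv (deriv f) w - 2 * (ρ t w * f w)) = 0 := by
    refine setIntegral_Ioi_eq_zero_of_tendsto (fun w hw => ?_)
      ((hint1 t ht).sub ((hint2 t ht).const_mul 2)) (hbd0 t ht) (hbdtop t ht)
    exact (((hFd w hw).mul (hfdd w hw)).sub ((hF'd w hw).mul (hfd w hw))).congr_deriv (by ring)
  rw [integral_sub (hint1 t ht) ((hint2 t ht).const_mul 2), integral_const_mul, sub_eq_zero]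
    at hzero
  have hGd : deriv G t = 2 * ∫ w in Ioi (0 : ℝ), ρ t w * f w := by
    rw [(hdiff t ht).deriv, ← hzero, ← integral_const_mul]
    refine setIntegral_congr_fun measurableSet_Ioi fun w hw => ?_
    simp only [hF, hFP t ht w hw]
    ring
  have hbound : ∫ w in Ioi (0 : ℝ), ρ t w * f w
      ≤ ∫ w in Ioi (0 : ℝ), γ / 2 * N * (M w * ρ t w) := by
    refine setIntegral_mono_ae_restrict (hint2 t ht) (hMp.const_mul _) ?_
    filter_upwards [ae_le_toReal_eLpNorm_top (hbdd t ht), ae_restrict_mem measurableSet_Ioi]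
      with w hwN hw
    have hρ := hp0 w hw
    have hMw := hM0 w hw
    calc ρ t w * f w = D t w * ρ t w * ρ t w := by simp only [hf]; ring
      _ ≤ γ / 2 * M w * ρ t w * ρ t w := by gcongr; exact hDM w hw
      _ ≤ γ / 2 * M w * ρ t w * N := by gcongr
      _ = γ / 2 * N * (M w * ρ t w) := by ring
  rw [integral_const_mul] at hbound
  rw [hGd, hGM]
  linarith
end
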